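/- arXiv:2101.10365 — 2 statements merged into one kernel-verified Lean document; each statement's English description precedes it below -/
import Mathlib

section
/- Under the hypotheses of the attraction-region theorem (with Δ > 0 a root of α_1 Δ^γ + b_3 Δ^{γ+μ} = a_1 δ^γ and 0 < δ < min{H_1, H_2}), every solution x(·,φ) of ẋ(t) = f(x(t), x(t−h)) with initial function ‖φ‖_H < Δ satisfies ‖x(t,φ)‖_{r,p} < δ for all t ≥ 0. -/
set_option linter.unusedVariables false

noncomputable def hnorm (n : ℕ) (r : Fin n → ℝ) (p : ℝ) (x : Fin n → ℝ) : ℝ :=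
  (∑ i, |x i| ^ (p / r i)) ^ (1 / p)

noncomputable def pd (n : ℕ) (f : (Fin n → ℝ) → (Fin n → ℝ) → (Fin n → ℝ))
    (i j : Fin n) (x y : Fin n → ℝ) : ℝ :=
  deriv (fun t => f (Function.update x j t) y i) (x j)

noncomputable def vfun (n : ℕ) (r : Fin n → ℝ) (p h μ γ w1 w2 : ℝ)
    (f : (Fin n → ℝ) → (Fin n → ℝ) → (Fin n → ℝ)) (V : (Fin n → ℝ) → ℝ)
    (φ : ℝ → Fin n → ℝ) : ℝ :=
  V (φ 0) + fderiv ℝ V (φ 0) (∫ θ in (-h)..(0:ℝ), f (φ 0) (φ θ))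
    + ∫ θ in (-h)..(0:ℝ), (w1 + (h + θ) * w2) * hnorm n r p (φ θ) ^ (γ + μ)

noncomputable def segNorm (n : ℕ) (r : Fin n → ℝ) (p h : ℝ)
    (x : ℝ → Fin n → ℝ) (t : ℝ) : ℝ :=
  sSup ((fun θ => hnorm n r p (x (t + θ))) '' Set.Icc (-h) 0)

def IsSol (n : ℕ) (h : ℝ) (f : (Fin n → ℝ) → (Fin n → ℝ) → (Fin n → ℝ))
    (x : ℝ → Fin n → ℝ) : Prop :=
  ContinuousOn x (Set.Ici (-h)) ∧
  ∀ t : ℝ, 0 ≤ t → HasDerivWithinAt x (f (x t) (x (t - h))) (Set.Ici 0) t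

section

open Set Filter Topology MeasureTheory

theorem hnorm_nonneg (n : ℕ) (r : Fin n → ℝ) (p : ℝ) (x : Fin n → ℝ) : 0 ≤ hnorm n r p x :=
  Real.rpow_nonneg (Finset.sum_nonneg fun _ _ => Real.rpow_nonneg (abs_nonneg _) _) _

theorem continuous_hnorm {n : ℕ} {r : Fin n → ℝ} {p : ℝ} (hr : ∀ i, 0 < r i) (hp : 0 < p) :
    Continuous (hnorm n r p) := by
  refine Continuous.rpow_const (continuous_finsetSum _ fun i _ => ?_) fun _ => Or.inr (by positivity)
  exact (continuous_apply i).abs.rpow_const fun _ => Or.inr (div_pos hp (hr i)).le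

theorem hnorm_one_pos {n : ℕ} (hn : 1 ≤ n) (r : Fin n → ℝ) (p : ℝ) :
    0 < hnorm n r p fun _ => 1 := by
  have : (0 : ℝ) < n := by exact_mod_cast hn
  simpa [hnorm] using Real.rpow_pos_of_pos this _

theorem rpow_mul_rpow_le_weighted {a b χ s q : ℝ} (ha : 0 ≤ a) (hb : 0 ≤ b) (hχ : 0 < χ)
    (hs : 0 ≤ s) (hq : 0 ≤ q) :
    a ^ s * b ^ q ≤ χ ^ (-2 * q) * a ^ (s + q) + χ ^ (2 * s) * b ^ (s + q) := by
  rw [Real.rpow_add_of_nonneg ha hs hq, Real.rpow_add_of_nonneg hb hs hq]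
  have hχ2 : χ ^ (2 * s) = (χ ^ (2 : ℝ)) ^ s := Real.rpow_mul hχ.le _ _
  have hχ3 : χ ^ (-2 * q) = (χ ^ (-2 : ℝ)) ^ q := Real.rpow_mul hχ.le _ _
  rcases le_total a (χ ^ (2 : ℝ) * b) with hab | hab
  · have : a ^ s ≤ χ ^ (2 * s) * b ^ s := by
      rw [hχ2, ← Real.mul_rpow (by positivity) hb]
      exact Real.rpow_le_rpow ha hab hs
    have h2 := mul_le_mul_of_nonneg_right this (Real.rpow_nonneg hb q)
    have : 0 ≤ χ ^ (-2 * q) * (a ^ s * a ^ q) := by positivity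
    linarith
  · have : b ^ q ≤ χ ^ (-2 * q) * a ^ q := by
      rw [hχ3, ← Real.mul_rpow (by positivity) ha]
      refine Real.rpow_le_rpow hb ?_ hq
      rw [Real.rpow_neg hχ.le, ← div_eq_inv_mul, le_div_iff₀ (by positivity)]
      linarith
    have h2 := mul_le_mul_of_nonneg_left this (Real.rpow_nonneg ha s)
    have : 0 ≤ χ ^ (2 * s) * (b ^ s * b ^ q) := by positivity
    linarith

theorem rpow_mul_three_le {x y z M e₁ e₂ e₃ : ℝ} (hx : 0 ≤ x) (hy : 0 ≤ y) (hz : 0 ≤ z)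
    (hxM : x ≤ M) (hyM : y ≤ M) (hzM : z ≤ M) (h₁ : 0 ≤ e₁) (h₂ : 0 ≤ e₂) (h₃ : 0 ≤ e₃) :
    x ^ e₁ * y ^ e₂ * z ^ e₃ ≤ M ^ (e₁ + e₂ + e₃) := by
  have hM : 0 ≤ M := hx.trans hxM
  rw [Real.rpow_add_of_nonneg hM (by positivity) h₃, Real.rpow_add_of_nonneg hM h₁ h₂]
  gcongr

theorem rpow_max_le_add {a b q : ℝ} (ha : 0 ≤ a) (hb : 0 ≤ b) :
    max a b ^ q ≤ a ^ q + b ^ q := by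
  rcases max_choice a b with h | h <;> rw [h] <;>
    linarith [Real.rpow_nonneg ha q, Real.rpow_nonneg hb q]

theorem rpow_mul_add_mul_add_le {a b c δ P ν e₁ e₂ e₃ : ℝ} (ha : 0 ≤ a) (hb : 0 ≤ b) (hc : 0 ≤ c)
    (haδ : a ≤ δ) (hbδ : b ≤ δ) (hcδ : c ≤ δ) (hP : 0 ≤ P) (hν : 0 ≤ ν)
    (h₁ : 0 ≤ e₁) (h₂ : 0 ≤ e₂) (h₃ : 0 ≤ e₃) (hsum : e₁ + e₂ + e₃ = P + ν) :
    a ^ e₁ * (a ^ e₂ + b ^ e₂) * (a ^ e₃ + c ^ e₃)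
      ≤ δ ^ ν * (4 * a ^ P + 2 * b ^ P + 2 * c ^ P) := by
  have key {y z M : ℝ} (hy : 0 ≤ y) (hz : 0 ≤ z) (haM : a ≤ M) (hyM : y ≤ M) (hzM : z ≤ M)
      (hMδ : M ≤ δ) : a ^ e₁ * y ^ e₂ * z ^ e₃ ≤ δ ^ ν * M ^ P := by
    have hM : 0 ≤ M := ha.trans haM
    refine (rpow_mul_three_le ha hy hz haM hyM hzM h₁ h₂ h₃).trans ?_
    rw [hsum, Real.rpow_add_of_nonneg hM hP hν, mul_comm]
    gcongr
  have h1 := key ha ha le_rfl le_rfl le_rfl haδ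
  have h2 := key hb ha (le_max_left a b) (le_max_right a b) (le_max_left a b) (max_le haδ hbδ)
  have h3 := key ha hc (le_max_left a c) (le_max_left a c) (le_max_right a c) (max_le haδ hcδ)
  have h4 := key hb hc ((le_max_left a b).trans (le_max_left _ c))
    ((le_max_right a b).trans (le_max_left _ c)) (le_max_right _ c)
    (max_le (max_le haδ hbδ) hcδ)
  have hδ : 0 ≤ δ ^ ν := Real.rpow_nonneg (ha.trans haδ) _
  have m2 := mul_le_mul_of_nonneg_left (rpow_max_le_add (q := P) ha hb) hδ
  have m3 := mul_le_mul_of_nonneg_left (rpow_max_le_add (q := P) ha hc) hδ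
  have m4 := mul_le_mul_of_nonneg_left ((rpow_max_le_add (q := P) (ha.trans (le_max_left a b)) hc).trans
    (add_le_add_left (rpow_max_le_add (q := P) ha hb) _)) hδ
  linarith

theorem clm_apply_eq_sum_single {n : ℕ} (A : (Fin n → ℝ) →L[ℝ] ℝ) (v : Fin n → ℝ) :
    A v = ∑ i, v i * A (Pi.single i 1) := by
  conv_lhs => rw [pi_eq_sum_univ' v]
  simp

theorem fderiv_single_eq_pd {n : ℕ} {f : (Fin n → ℝ) → (Fin n → ℝ) → (Fin n → ℝ)}
    {x y : Fin n → ℝ} {i : Fin n} (hf : DifferentiableAt ℝ (fun z => f z y i) x) (j : Fin n) :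
    fderiv ℝ (fun z => f z y i) x (Pi.single j 1) = pd n f i j x y := by
  have hx : Function.update x j (x j) = x := Function.update_eq_self j x
  have h1 : HasFDerivAt (fun z => f z y i) (fderiv ℝ (fun z => f z y i) x)
      (Function.update x j (x j)) := by rw [hx]; exact hf.hasFDerivAt
  exact (h1.comp_hasDerivAt (x j) (hasDerivAt_update x j (x j))).deriv.symm

theorem exists_lipschitzOnWith_closedBall {n : ℕ} {r : Fin n → ℝ} {p μ : ℝ}
    (hN : Continuous (hnorm n r p)) {f : (Fin n → ℝ) → (Fin n → ℝ) → (Fin n → ℝ)}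
    (hf_cd : ∀ y : Fin n → ℝ, ContDiff ℝ 1 fun x => f x y)
    {η : Fin n → Fin n → ℝ} (hη : ∀ i j, 0 < η i j)
    (hfd1 : ∀ i j, 0 ≤ μ + r i - r j → ∀ x y : Fin n → ℝ,
      |pd n f i j x y| ≤ η i j * (hnorm n r p x ^ (μ + r i - r j) + hnorm n r p y ^ (μ + r i - r j)))
    (hfd2 : ∀ i j, μ + r i - r j < 0 → ∀ x y : Fin n → ℝ, |pd n f i j x y| ≤ η i j) (R : ℝ) :
    ∃ K : NNReal, ∀ y ∈ Metric.closedBall (0 : Fin n → ℝ) R, ∀ i,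
      LipschitzOnWith K (fun z => f z y i) (Metric.closedBall 0 R) := by
  obtain ⟨B, hB⟩ := (isCompact_closedBall (0 : Fin n → ℝ) R).bddAbove_image hN.continuousOn
  have hB' (z : Fin n → ℝ) (hz : z ∈ Metric.closedBall (0 : Fin n → ℝ) R) : hnorm n r p z ≤ B :=
    hB (mem_image_of_mem _ hz)
  set c : Fin n → Fin n → ℝ := fun i j => η i j * (2 * |B| ^ (μ + r i - r j) + 1) with hc
  have hc0 (i j : Fin n) : 0 ≤ c i j := by have := hη i j; positivity
  have hpd (i j : Fin n) (z y : Fin n → ℝ) (hz : z ∈ Metric.closedBall (0 : Fin n → ℝ) R)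
      (hy : y ∈ Metric.closedBall (0 : Fin n → ℝ) R) : |pd n f i j z y| ≤ c i j := by
    rcases le_or_gt 0 (μ + r i - r j) with he | he
    · refine (hfd1 i j he z y).trans (mul_le_mul_of_nonneg_left ?_ (hη i j).le)
      have h1 := Real.rpow_le_rpow (hnorm_nonneg n r p z) ((hB' z hz).trans (le_abs_self B)) he
      have h2 := Real.rpow_le_rpow (hnorm_nonneg n r p y) ((hB' y hy).trans (le_abs_self B)) he
      linarith
    · refine (hfd2 i j he z y).trans (le_mul_of_one_le_right (hη i j).le ?_)
      have : 0 ≤ |B| ^ (μ + r i - r j) := by positivity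
      linarith
  obtain ⟨K, hK⟩ : ∃ K : NNReal, (K : ℝ) = ∑ i, ∑ j, c i j :=
    ⟨Real.toNNReal _, Real.coe_toNNReal _
      (Finset.sum_nonneg fun i _ => Finset.sum_nonneg fun j _ => hc0 i j)⟩
  refine ⟨K, fun y hy i => ?_⟩
  have hd (z : Fin n → ℝ) : DifferentiableAt ℝ (fun z => f z y i) z :=
    (differentiable_pi.1 ((hf_cd y).differentiable one_ne_zero) i) z
  refine Convex.lipschitzOnWith_of_nnnorm_fderiv_le (𝕜 := ℝ) (fun z _ => hd z) (fun z hz => ?_)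
    (convex_closedBall 0 R)
  rw [← NNReal.coe_le_coe, coe_nnnorm, hK]
  refine ContinuousLinearMap.opNorm_le_bound _ (hK ▸ K.2) fun v => ?_
  rw [clm_apply_eq_sum_single]
  calc ‖∑ j, v j * fderiv ℝ (fun z => f z y i) z (Pi.single j 1)‖
      ≤ ∑ j, ‖v j * fderiv ℝ (fun z => f z y i) z (Pi.single j 1)‖ := norm_sum_le _ _
    _ ≤ ∑ j, c i j * ‖v‖ := by
        refine Finset.sum_le_sum fun j _ => ?_
        rw [fderiv_single_eq_pd (hd z), norm_mul, mul_comm]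
        exact mul_le_mul (hpd i j z y hz hy) (norm_le_pi_norm v j) (norm_nonneg _) (hc0 i j)
    _ ≤ (∑ i, ∑ j, c i j) * ‖v‖ := by
        rw [← Finset.sum_mul]
        refine mul_le_mul_of_nonneg_right ?_ (norm_nonneg v)
        exact Finset.single_le_sum (f := fun i => ∑ j, c i j)
          (fun i _ => Finset.sum_nonneg fun j _ => hc0 i j) (Finset.mem_univ i)

theorem continuous_uncurry_of_lipschitzOnWith {n : ℕ}
    {f : (Fin n → ℝ) → (Fin n → ℝ) → (Fin n → ℝ)}
    (hf_lip : ∀ x : Fin n → ℝ, LocallyLipschitz fun y => f x y)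
    (hK : ∀ R : ℝ, ∃ K : NNReal, ∀ y ∈ Metric.closedBall (0 : Fin n → ℝ) R, ∀ i,
      LipschitzOnWith K (fun z => f z y i) (Metric.closedBall 0 R)) (i : Fin n) :
    Continuous fun q : (Fin n → ℝ) × (Fin n → ℝ) => f q.1 q.2 i := by
  rw [continuous_iff_continuousAt]
  rintro ⟨x, y⟩
  obtain ⟨K, hK⟩ := hK (max ‖x‖ ‖y‖ + 1)
  refine (continuousOn_prod_of_continuousOn_lipschitzOnWith _ K
    (fun a _ => ((continuous_apply i).comp (hf_lip a).continuous).continuousOn)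
    (fun b hb => hK b hb i)).continuousAt (prod_mem_nhds ?_ ?_)
  · refine Metric.closedBall_mem_nhds_of_mem ?_
    rw [Metric.mem_ball, dist_zero_right]
    linarith [le_max_left ‖x‖ ‖y‖]
  · refine Metric.closedBall_mem_nhds_of_mem ?_
    rw [Metric.mem_ball, dist_zero_right]
    linarith [le_max_right ‖x‖ ‖y‖]

theorem contDiff_fderiv_single {n : ℕ} {V : (Fin n → ℝ) → ℝ} (hV : ContDiff ℝ 2 V) (i : Fin n) :
    ContDiff ℝ 1 fun z => fderiv ℝ V z (Pi.single i 1) :=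
  (hV.fderiv_right (m := 1) (by norm_num)).clm_apply contDiff_const

theorem intervalIntegral_window {n : ℝ → ℝ} (hn : Continuous n) (d h τ : ℝ) :
    ∫ s in (0 : ℝ)..τ, ∫ u in (s + d)..(s + d + h), n u
      = ∫ σ in (0 : ℝ)..h, ∫ s in (d + σ)..(τ + d + σ), n s := by
  have hcont : Continuous (Function.uncurry fun s σ : ℝ => n (s + (d + σ))) := by
    simp only [Function.uncurry_def]
    fun_prop
  have hl (s : ℝ) : ∫ u in (s + d)..(s + d + h), n u = ∫ σ in (0 : ℝ)..h, n (s + (d + σ)) := by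
    simp_rw [← add_assoc s d]
    rw [intervalIntegral.integral_comp_add_left n (s + d), add_zero]
  have hr (σ : ℝ) : ∫ s in (d + σ)..(τ + d + σ), n s = ∫ s in (0 : ℝ)..τ, n (s + (d + σ)) := by
    rw [intervalIntegral.integral_comp_add_right n (d + σ), zero_add, add_assoc]
  simp_rw [hl, hr]
  refine intervalIntegral_intervalIntegral_swap ?_
  exact ((hcont.continuousOn (s := uIcc 0 τ ×ˢ uIcc 0 h)).integrableOn_compact
    (isCompact_uIcc.prod isCompact_uIcc)).mono_set (prod_mono uIoc_subset_uIcc uIoc_subset_uIcc)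

theorem integral_window_forward_le {n : ℝ → ℝ} (hn : Continuous n) {h τ C : ℝ} (hh : 0 ≤ h)
    (hτ : 0 ≤ τ) (hC : ∀ s ∈ Icc 0 (τ + h), n s ≤ C) :
    ∫ s in (0 : ℝ)..τ, ∫ u in s..(s + h), n u
      ≤ h * ((∫ s in (0 : ℝ)..τ, n s) + (h * C - ∫ s in (0 : ℝ)..h, n s)) := by
  have hi (a b : ℝ) : IntervalIntegrable n volume a b := hn.intervalIntegrable a b
  have hwin := intervalIntegral_window hn 0 h τ
  simp only [add_zero, zero_add] at hwin
  rw [hwin]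
  have hcont : Continuous fun σ => ∫ s in σ..(τ + σ), n s := by
    have hJ : Continuous fun b => ∫ s in (0 : ℝ)..b, n s :=
      intervalIntegral.continuous_primitive hi 0
    have : (fun σ => ∫ s in σ..(τ + σ), n s)
        = fun σ => (∫ s in (0 : ℝ)..(τ + σ), n s) - ∫ s in (0 : ℝ)..σ, n s := by
      funext σ
      exact (intervalIntegral.integral_interval_sub_left (hi _ _) (hi _ _)).symm
    rw [this]
    exact (hJ.comp (continuous_const.add continuous_id)).sub hJ
  refine (intervalIntegral.integral_mono_on hh (hcont.intervalIntegrable _ _)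
    (intervalIntegrable_const (c := (∫ s in (0 : ℝ)..τ, n s)
      + (h * C - ∫ s in (0 : ℝ)..h, n s))) fun σ hσ => ?_).trans_eq (by simp; ring)
  have h1 : ∫ s in τ..(τ + σ), n s ≤ σ * C := by
    refine (intervalIntegral.integral_mono_on (by linarith [hσ.1]) (hi _ _)
      (intervalIntegrable_const (c := C)) fun s hs => hC s ?_).trans_eq (by simp)
    exact ⟨by linarith [hs.1], by linarith [hs.2, hσ.2]⟩
  have h2 : ∫ s in σ..h, n s ≤ (h - σ) * C := by
    refine (intervalIntegral.integral_mono_on hσ.2 (hi _ _)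
      (intervalIntegrable_const (c := C)) fun s hs => hC s ?_).trans_eq (by simp)
    exact ⟨by linarith [hs.1, hσ.1], by linarith [hs.2]⟩
  have e1 := intervalIntegral.integral_add_adjacent_intervals (hi 0 σ) (hi σ (τ + σ))
  have e2 := intervalIntegral.integral_add_adjacent_intervals (hi 0 τ) (hi τ (τ + σ))
  have e3 := intervalIntegral.integral_add_adjacent_intervals (hi 0 σ) (hi σ h)
  linarith

theorem integral_window_backward_le {n : ℝ → ℝ} (hn : Continuous n) {h τ B : ℝ} (hh : 0 ≤ h)
    (hτ : 0 ≤ τ) (hn0 : ∀ s, 0 ≤ n s) (hB : ∀ s ∈ Icc (-h) 0, n s ≤ B) :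
    ∫ s in (0 : ℝ)..τ, ∫ u in (s - h)..s, n u ≤ h * (h * B + ∫ s in (0 : ℝ)..τ, n s) := by
  have hi (a b : ℝ) : IntervalIntegrable n volume a b := hn.intervalIntegrable a b
  have hwin := intervalIntegral_window hn (-h) h τ
  simp only [← sub_eq_add_neg, sub_add_cancel] at hwin
  rw [hwin]
  have hinner (σ : ℝ) (hσ : σ ∈ Icc 0 h) :
      ∫ s in (-h + σ)..(τ - h + σ), n s ≤ h * B + ∫ s in (0 : ℝ)..τ, n s := by
    have h1 : ∫ s in (-h + σ)..(τ - h + σ), n s ≤ ∫ s in (-h)..τ, n s :=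
      intervalIntegral.integral_mono_interval (by linarith [hσ.1]) (by linarith)
        (by linarith [hσ.2]) (Eventually.of_forall hn0) (hi _ _)
    have h2 : ∫ s in (-h)..0, n s ≤ h * B :=
      (intervalIntegral.integral_mono_on (by linarith) (hi _ _)
        (intervalIntegrable_const (c := B)) hB).trans_eq (by simp)
    have e := intervalIntegral.integral_add_adjacent_intervals (hi (-h) 0) (hi 0 τ)
    linarith
  have hcont : Continuous fun σ => ∫ s in (-h + σ)..(τ - h + σ), n s := by
    have hJ : Continuous fun b => ∫ s in (0 : ℝ)..b, n s :=
      intervalIntegral.continuous_primitive hi 0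
    have : (fun σ => ∫ s in (-h + σ)..(τ - h + σ), n s)
        = fun σ => (∫ s in (0 : ℝ)..(τ - h + σ), n s) - ∫ s in (0 : ℝ)..(-h + σ), n s := by
      funext σ
      exact (intervalIntegral.integral_interval_sub_left (hi _ _) (hi _ _)).symm
    rw [this]
    exact (hJ.comp (continuous_const.add continuous_id)).sub
      (hJ.comp (continuous_const.add continuous_id))
  exact (intervalIntegral.integral_mono_on hh (hcont.intervalIntegrable _ _)
    (intervalIntegrable_const (c := h * B + ∫ s in (0 : ℝ)..τ, n s)) hinner).trans_eq
    (by simp; ring)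

/-- Growth bound for `v' u = G u (u - h)`: after time `h` the delayed argument is traded for the
undelayed one, at the price of the increments `G (s + h) s - G s s`. -/
theorem sub_le_of_delayed_deriv {v n : ℝ → ℝ} {G : ℝ → ℝ → ℝ} {h w w1 w2 c Q B C T : ℝ}
    (hh : 0 < h) (hT : 0 ≤ T) (hv : Continuous v) (hn : Continuous n) (hn0 : ∀ s, 0 ≤ n s)
    (hG : Continuous (Function.uncurry G)) (hQ : 0 ≤ Q) (hc : 0 ≤ c) (hw1 : 0 ≤ w1) (hw2 : 0 ≤ w2)
    (hv' : ∀ u, 0 < u → HasDerivAt v (G u (u - h)) u)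
    (hdiag : ∀ s, 0 ≤ s → G s s ≤ -w * n s)
    (hincr : ∀ s, 0 ≤ s → s + h ≤ T →
      G (s + h) s - G s s ≤ ∫ u in s..(s + h), c * (4 * n u + 2 * n s + 2 * n (u - h)))
    (hinit : ∀ u ∈ Icc 0 h, G u (u - h) ≤ Q * n u + w1 * B)
    (hC : ∀ s ∈ Icc 0 T, n s ≤ C) (hB : ∀ s ∈ Icc (-h) 0, n s ≤ B)
    (hc0 : c * (4 * h) ≤ w - w1 - h * w2) (hc1 : c * (2 * h) ≤ w1) (hc2 : c * 2 ≤ w2)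
    (hwQ : w - w1 - h * w2 ≤ Q) :
    v T - v 0 ≤ Q * (h * C) + (w1 + h * w2) * h * B := by
  have hB0 : 0 ≤ B := (hn0 0).trans (hB 0 ⟨by linarith, le_rfl⟩)
  have hC0 : 0 ≤ C := (hn0 0).trans (hC 0 ⟨le_rfl, hT⟩)
  have hi (a b : ℝ) : IntervalIntegrable n volume a b := hn.intervalIntegrable a b
  have hdelay : Continuous fun u => G u (u - h) :=
    hG.comp (continuous_id.prodMk (continuous_id.sub continuous_const))
  have hFTC : ∫ u in (0 : ℝ)..T, G u (u - h) = v T - v 0 :=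
    intervalIntegral.integral_eq_sub_of_hasDerivAt_of_le hT hv.continuousOn
      (fun u hu => hv' u hu.1) (hdelay.intervalIntegrable _ _)
  have hfirst (b : ℝ) (hb : 0 ≤ b) (hbh : b ≤ h) :
      ∫ u in (0 : ℝ)..b, G u (u - h) ≤ Q * (∫ u in (0 : ℝ)..b, n u) + b * (w1 * B) := by
    refine (intervalIntegral.integral_mono_on (g := fun u => Q * n u + w1 * B) hb
      (hdelay.intervalIntegrable _ _) (Continuous.intervalIntegrable (by fun_prop) _ _)
      fun u hu => hinit u ⟨hu.1, hu.2.trans hbh⟩).trans_eq ?_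
    rw [intervalIntegral.integral_add ((hi _ _).const_mul Q) intervalIntegrable_const,
      intervalIntegral.integral_const_mul]
    simp
    ring
  have hnC (b : ℝ) (hb : 0 ≤ b) (hbT : b ≤ T) : ∫ u in (0 : ℝ)..b, n u ≤ b * C :=
    (intervalIntegral.integral_mono_on hb (hi _ _) (intervalIntegrable_const (c := C))
      fun u hu => hC u ⟨hu.1, hu.2.trans hbT⟩).trans_eq (by simp)
  have hwB : 0 ≤ h * w2 * h * B := by positivity
  rcases le_total T h with hTh | hTh
  · rw [← hFTC]
    have h1 := mul_le_mul_of_nonneg_left ((hnC T hT le_rfl).trans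
      (mul_le_mul_of_nonneg_right hTh hC0)) hQ
    have h2 := mul_le_mul_of_nonneg_right hTh (mul_nonneg hw1 hB0)
    linarith [hfirst T hT hTh]
  · set τ := T - h with hτdef
    have hτ : 0 ≤ τ := by linarith
    have hτT : τ + h = T := by linarith
    have hshift : ∫ u in h..T, G u (u - h) = ∫ s in (0 : ℝ)..τ, G (s + h) s := by
      have := intervalIntegral.integral_comp_add_right (a := 0) (b := τ)
        (fun u => G u (u - h)) h
      rw [zero_add, hτT] at this
      rw [← this]
      simp
    have hsplit := intervalIntegral.integral_add_adjacent_intervals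
      (hdelay.intervalIntegrable (μ := volume) 0 h) (hdelay.intervalIntegrable h T)
    have hJ : Continuous fun b => ∫ s in (0 : ℝ)..b, n s :=
      intervalIntegral.continuous_primitive hi 0
    have hJw (f g : ℝ → ℝ) (hf : Continuous f) (hg : Continuous g) :
        Continuous fun s => ∫ u in f s..g s, n u := by
      have : (fun s => ∫ u in f s..g s, n u)
          = fun s => (∫ u in (0 : ℝ)..g s, n u) - ∫ u in (0 : ℝ)..f s, n u := by
        funext s
        exact (intervalIntegral.integral_interval_sub_left (hi _ _) (hi _ _)).symm
      rw [this]
      exact (hJ.comp hg).sub (hJ.comp hf)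
    have hF : Continuous fun s => ∫ u in s..(s + h), n u := hJw _ _ (by fun_prop) (by fun_prop)
    have hK : Continuous fun s => ∫ u in (s - h)..s, n u := hJw _ _ (by fun_prop) (by fun_prop)
    have hpt (s : ℝ) (hs : s ∈ Icc 0 τ) : G (s + h) s
        ≤ (-w + c * (2 * h)) * n s + (4 * c) * (∫ u in s..(s + h), n u)
          + (2 * c) * ∫ u in (s - h)..s, n u := by
      have h1 := hincr s hs.1 (by linarith [hs.2])
      have h2 := hdiag s hs.1
      have hsh : Continuous fun u => n (u - h) := by fun_prop
      rw [intervalIntegral.integral_const_mul, intervalIntegral.integral_add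
        (((hi _ _).const_mul 4).add intervalIntegrable_const)
        ((hsh.intervalIntegrable _ _).const_mul 2),
        intervalIntegral.integral_add ((hi _ _).const_mul 4) intervalIntegrable_const,
        intervalIntegral.integral_const_mul, intervalIntegral.integral_const_mul,
        intervalIntegral.integral_const_mul,
        intervalIntegral.integral_comp_sub_right n h, intervalIntegral.integral_const,
        add_sub_cancel_right, add_sub_cancel_left, smul_eq_mul] at h1
      linarith
    have hGc : Continuous fun s => G (s + h) s :=
      hG.comp ((continuous_id.add continuous_const).prodMk continuous_id)
    have hlate := intervalIntegral.integral_mono_on (μ := volume) hτ (hGc.intervalIntegrable _ _)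
      (Continuous.intervalIntegrable (by fun_prop) _ _) hpt
    rw [intervalIntegral.integral_add
        (((hi _ _).const_mul _).add ((hF.intervalIntegrable _ _).const_mul _))
        ((hK.intervalIntegrable _ _).const_mul _),
      intervalIntegral.integral_add ((hi _ _).const_mul _) ((hF.intervalIntegrable _ _).const_mul _),
      intervalIntegral.integral_const_mul, intervalIntegral.integral_const_mul,
      intervalIntegral.integral_const_mul] at hlate
    have hfw := integral_window_forward_le hn hh.le hτ (C := C) (by rwa [hτT])
    have hbw := integral_window_backward_le hn hh.le hτ hn0 hB
    have hearly := hfirst h hh.le le_rfl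
    set I := ∫ s in (0 : ℝ)..τ, n s with hI
    have hI0 : 0 ≤ I := intervalIntegral.integral_nonneg hτ fun s _ => hn0 s
    set D := h * C - ∫ s in (0 : ℝ)..h, n s with hD
    have hD0 : 0 ≤ D := by linarith [hnC h hh.le hTh]
    have hID : 0 ≤ I + D := by linarith
    have hIB : 0 ≤ h * (h * B + I) := by positivity
    have k0 := mul_le_mul_of_nonneg_right hc0 hID
    have k1 := mul_le_mul_of_nonneg_right hc1 hI0
    have k2 := mul_le_mul_of_nonneg_right hc2 hIB
    have k3 := mul_le_mul_of_nonneg_right hwQ hD0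
    have k4 := mul_le_mul_of_nonneg_left hfw (by linarith : 0 ≤ 4 * c)
    have k5 := mul_le_mul_of_nonneg_left hbw (by linarith : 0 ≤ 2 * c)
    have hn1 : ∫ s in (0 : ℝ)..h, n s = h * C - D := by rw [hD]; ring
    rw [hn1] at hearly
    rw [← hFTC, ← hsplit, hshift]
    linarith

theorem sum_second_variation_le {n : ℕ} {r : Fin n → ℝ} (hr : ∀ i, 0 < r i) {p μ : ℝ} (hμ : 0 < μ)
    {f : (Fin n → ℝ) → (Fin n → ℝ) → (Fin n → ℝ)}
    {m : Fin n → ℝ} (hm : ∀ i, 0 < m i)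
    (hfm : ∀ x y : Fin n → ℝ, ∀ i,
      |f x y i| ≤ m i * (hnorm n r p x ^ (μ + r i) + hnorm n r p y ^ (μ + r i)))
    {η : Fin n → Fin n → ℝ} (hη : ∀ i j, 0 < η i j)
    (hfd1 : ∀ i j, 0 ≤ μ + r i - r j → ∀ x y : Fin n → ℝ,
      |pd n f i j x y| ≤ η i j * (hnorm n r p x ^ (μ + r i - r j) + hnorm n r p y ^ (μ + r i - r j)))
    (hfd2 : ∀ i j, μ + r i - r j < 0 → ∀ x y : Fin n → ℝ, |pd n f i j x y| ≤ η i j)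
    {V : (Fin n → ℝ) → ℝ} {γ : ℝ} (hγ0 : 0 ≤ γ) (hγ : ∀ i, 2 * r i ≤ γ)
    {β : Fin n → ℝ} (hβ : ∀ i, 0 < β i)
    (hVd : ∀ x : Fin n → ℝ, ∀ i,
      |fderiv ℝ V x (Pi.single i 1)| ≤ β i * hnorm n r p x ^ (γ - r i))
    {ψ : Fin n → Fin n → ℝ} (hψ : ∀ i j, 0 < ψ i j)
    (hVdd : ∀ x : Fin n → ℝ, ∀ i j,
      |fderiv ℝ (fun z => fderiv ℝ V z (Pi.single i 1)) x (Pi.single j 1)|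
        ≤ ψ i j * hnorm n r p x ^ (γ - r i - r j))
    {δ : ℝ} (hδ0 : 0 < δ) {x y z : Fin n → ℝ} (hx : hnorm n r p x ≤ δ) (hy : hnorm n r p y ≤ δ)
    (hz : hnorm n r p z ≤ δ) :
    ∑ i, ((∑ j, f x z j * fderiv ℝ (fun z => fderiv ℝ V z (Pi.single i 1)) x (Pi.single j 1))
            * f x y i
          + fderiv ℝ V x (Pi.single i 1) * ∑ j, f x z j * pd n f i j x y)
      ≤ δ ^ μ * (∑ i, ∑ j, m j * (β i * η i j *
          (if 0 ≤ μ + r i - r j then 1 else δ ^ (r j - r i - μ)) + m i * ψ i j))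
        * (4 * hnorm n r p x ^ (γ + μ) + 2 * hnorm n r p y ^ (γ + μ)
          + 2 * hnorm n r p z ^ (γ + μ)) := by
  have hP : 0 ≤ γ + μ := by linarith
  set X := f x z with hX
  have hXb (j : Fin n) : |X j| ≤ m j * (hnorm n r p x ^ (μ + r j) + hnorm n r p z ^ (μ + r j)) :=
    hfm _ _ j
  have hfy := hfm x y
  have hVdx := hVd x
  have hVddx := hVdd x
  have hfd1xy (i j : Fin n) (he : 0 ≤ μ + r i - r j) := hfd1 i j he x y
  have hfd2xy (i j : Fin n) (he : μ + r i - r j < 0) := hfd2 i j he x y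
  have ha0 : 0 ≤ hnorm n r p x := hnorm_nonneg n r p x
  have hb0 : 0 ≤ hnorm n r p y := hnorm_nonneg n r p y
  have hc0 : 0 ≤ hnorm n r p z := hnorm_nonneg n r p z
  generalize hnorm n r p x = a at *
  generalize hnorm n r p y = b at *
  generalize hnorm n r p z = c at *
  rw [Finset.mul_sum, Finset.sum_mul]
  refine Finset.sum_le_sum fun i _ => ?_
  rw [Finset.sum_mul, Finset.mul_sum, Finset.mul_sum, Finset.sum_mul, ← Finset.sum_add_distrib]
  refine Finset.sum_le_sum fun j _ => ?_
  have := hm i; have := hm j; have := hψ i j; have := hβ i; have := hη i j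
  have hess : X j * fderiv ℝ (fun z => fderiv ℝ V z (Pi.single i 1)) x (Pi.single j 1) * f x y i
      ≤ m j * (m i * ψ i j) * (δ ^ μ * (4 * a ^ (γ + μ) + 2 * b ^ (γ + μ) + 2 * c ^ (γ + μ))) := by
    have hprod := rpow_mul_add_mul_add_le ha0 hb0 hc0 hx hy hz hP hμ.le
      (e₁ := γ - r i - r j) (e₂ := μ + r i) (e₃ := μ + r j)
      (by linarith [hγ i, hγ j]) (by linarith [hr i]) (by linarith [hr j]) (by ring)
    refine (le_abs_self _).trans ?_
    rw [abs_mul, abs_mul]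
    calc _ ≤ m j * (a ^ (μ + r j) + c ^ (μ + r j)) * (ψ i j * a ^ (γ - r i - r j))
          * (m i * (a ^ (μ + r i) + b ^ (μ + r i))) :=
        mul_le_mul (mul_le_mul (hXb j) (hVddx i j) (abs_nonneg _) (by positivity))
          (hfy i) (abs_nonneg _) (by positivity)
      _ = m j * (m i * ψ i j) * (a ^ (γ - r i - r j) * (a ^ (μ + r i) + b ^ (μ + r i))
          * (a ^ (μ + r j) + c ^ (μ + r j))) := by ring
      _ ≤ _ := mul_le_mul_of_nonneg_left hprod (by positivity)
  have grad : fderiv ℝ V x (Pi.single i 1) * (X j * pd n f i j x y)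
      ≤ m j * (β i * η i j * (if 0 ≤ μ + r i - r j then 1 else δ ^ (r j - r i - μ)))
        * (δ ^ μ * (4 * a ^ (γ + μ) + 2 * b ^ (γ + μ) + 2 * c ^ (γ + μ))) := by
    refine (le_abs_self _).trans ?_
    rw [abs_mul, abs_mul]
    split_ifs with he
    · have hprod := rpow_mul_add_mul_add_le ha0 hb0 hc0 hx hy hz hP hμ.le
        (e₁ := γ - r i) (e₂ := μ + r i - r j) (e₃ := μ + r j)
        (by linarith [hγ i, hr i]) he (by linarith [hr j]) (by ring)
      calc _ ≤ β i * a ^ (γ - r i) * (m j * (a ^ (μ + r j) + c ^ (μ + r j))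
            * (η i j * (a ^ (μ + r i - r j) + b ^ (μ + r i - r j)))) :=
          mul_le_mul (hVdx i) (mul_le_mul (hXb j) (hfd1xy i j he) (abs_nonneg _)
            (by positivity)) (by positivity) (by positivity)
        _ = m j * (β i * η i j * 1) * (a ^ (γ - r i) * (a ^ (μ + r i - r j) + b ^ (μ + r i - r j))
            * (a ^ (μ + r j) + c ^ (μ + r j))) := by ring
        _ ≤ _ := mul_le_mul_of_nonneg_left hprod (by positivity)
    · rw [not_le] at he
      have hprod := rpow_mul_add_mul_add_le ha0 hb0 hc0 hx hy hz hP
        (ν := μ + (r j - r i - μ)) (by linarith [hμ])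
        (e₁ := γ - r i) (e₂ := 0) (e₃ := μ + r j)
        (by linarith [hγ i, hr i]) le_rfl (by linarith [hr j]) (by ring)
      rw [Real.rpow_zero, Real.rpow_zero, Real.rpow_add hδ0] at hprod
      have hle : a ^ (γ - r i) * (a ^ (μ + r j) + c ^ (μ + r j))
          ≤ a ^ (γ - r i) * (1 + 1) * (a ^ (μ + r j) + c ^ (μ + r j)) := by
        have : 0 ≤ a ^ (γ - r i) * (a ^ (μ + r j) + c ^ (μ + r j)) := by positivity
        linarith
      calc _ ≤ β i * a ^ (γ - r i) * (m j * (a ^ (μ + r j) + c ^ (μ + r j)) * η i j) :=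
          mul_le_mul (hVdx i) (mul_le_mul (hXb j) (hfd2xy i j he) (abs_nonneg _)
            (by positivity)) (by positivity) (by positivity)
        _ = m j * (β i * η i j) * (a ^ (γ - r i) * (a ^ (μ + r j) + c ^ (μ + r j))) := by ring
        _ ≤ m j * (β i * η i j) * (δ ^ μ * δ ^ (r j - r i - μ)
            * (4 * a ^ (γ + μ) + 2 * b ^ (γ + μ) + 2 * c ^ (γ + μ))) :=
          mul_le_mul_of_nonneg_left (hle.trans hprod) (by positivity)
        _ = _ := by ring
  refine (add_le_add hess grad).trans_eq (by ring)

theorem fderiv_apply_le {n : ℕ} {r : Fin n → ℝ} (hr : ∀ i, 0 < r i) {p μ : ℝ} (hμ : 0 < μ)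
    {f : (Fin n → ℝ) → (Fin n → ℝ) → (Fin n → ℝ)}
    {m : Fin n → ℝ} (hm : ∀ i, 0 < m i)
    (hfm : ∀ x y : Fin n → ℝ, ∀ i,
      |f x y i| ≤ m i * (hnorm n r p x ^ (μ + r i) + hnorm n r p y ^ (μ + r i)))
    {V : (Fin n → ℝ) → ℝ} {γ : ℝ} (hγ : ∀ i, 2 * r i ≤ γ)
    {β : Fin n → ℝ} (hβ : ∀ i, 0 < β i)
    (hVd : ∀ x : Fin n → ℝ, ∀ i,
      |fderiv ℝ V x (Pi.single i 1)| ≤ β i * hnorm n r p x ^ (γ - r i))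
    {χ : ℝ} (hχ : 0 < χ) (x y : Fin n → ℝ) :
    |fderiv ℝ V x (f x y)|
      ≤ (∑ i, β i * m i * (1 + χ ^ (-2 * (μ + r i)))) * hnorm n r p x ^ (γ + μ)
        + (∑ i, β i * m i * χ ^ (2 * (γ - r i))) * hnorm n r p y ^ (γ + μ) := by
  have ha0 : 0 ≤ hnorm n r p x := hnorm_nonneg n r p x
  have hb0 : 0 ≤ hnorm n r p y := hnorm_nonneg n r p y
  rw [clm_apply_eq_sum_single, Finset.sum_mul, Finset.sum_mul, ← Finset.sum_add_distrib]
  refine (Finset.abs_sum_le_sum_abs _ _).trans (Finset.sum_le_sum fun i _ => ?_)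
  have hV := hVd x i
  have hf := hfm x y i
  generalize hnorm n r p x = a at *
  generalize hnorm n r p y = b at *
  have := hm i; have := hβ i
  have hγr : 0 ≤ γ - r i := by linarith [hγ i, hr i]
  have hμr : 0 ≤ μ + r i := by linarith [hr i]
  have hY := rpow_mul_rpow_le_weighted ha0 hb0 hχ hγr hμr
  have haa := Real.rpow_add_of_nonneg ha0 hγr hμr
  rw [show γ - r i + (μ + r i) = γ + μ by ring] at hY haa
  rw [abs_mul, mul_comm]
  calc _ ≤ β i * a ^ (γ - r i) * (m i * (a ^ (μ + r i) + b ^ (μ + r i))) :=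
      mul_le_mul hV hf (abs_nonneg _) (by positivity)
    _ = β i * m i * (a ^ (γ + μ) + a ^ (γ - r i) * b ^ (μ + r i)) := by rw [haa]; ring
    _ ≤ β i * m i * (a ^ (γ + μ) + (χ ^ (-2 * (μ + r i)) * a ^ (γ + μ)
        + χ ^ (2 * (γ - r i)) * b ^ (γ + μ))) := by gcongr
    _ = _ := by ring

theorem decay_rate_le {n : ℕ} (hn : 1 ≤ n) {r : Fin n → ℝ} (hr : ∀ i, 0 < r i) {p μ : ℝ}
    (hμ : 0 < μ) {f : (Fin n → ℝ) → (Fin n → ℝ) → (Fin n → ℝ)}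
    {m : Fin n → ℝ} (hm : ∀ i, 0 < m i)
    (hfm : ∀ x y : Fin n → ℝ, ∀ i,
      |f x y i| ≤ m i * (hnorm n r p x ^ (μ + r i) + hnorm n r p y ^ (μ + r i)))
    {V : (Fin n → ℝ) → ℝ} {γ : ℝ} (hγ : ∀ i, 2 * r i ≤ γ)
    {β : Fin n → ℝ} (hβ : ∀ i, 0 < β i)
    (hVd : ∀ x : Fin n → ℝ, ∀ i,
      |fderiv ℝ V x (Pi.single i 1)| ≤ β i * hnorm n r p x ^ (γ - r i))
    {w : ℝ} (hVf : ∀ x : Fin n → ℝ, fderiv ℝ V x (f x x) ≤ -w * hnorm n r p x ^ (γ + μ))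
    {χ : ℝ} (hχ : 0 < χ) :
    w ≤ (∑ i, β i * m i * (1 + χ ^ (-2 * (μ + r i)))) + ∑ i, β i * m i * χ ^ (2 * (γ - r i)) := by
  have hpos : 0 < hnorm n r p (fun _ => 1) ^ (γ + μ) :=
    Real.rpow_pos_of_pos (hnorm_one_pos hn r p) _
  have h1 := hVf fun _ => 1
  have h2 := (neg_le_abs _).trans (fderiv_apply_le hr hμ hm hfm hγ hβ hVd hχ (fun _ => 1) fun _ => 1)
  rw [← add_mul] at h2
  exact le_of_mul_le_mul_right (by linarith) hpos

theorem hasDerivAt_fderiv_apply {n : ℕ} {f : (Fin n → ℝ) → (Fin n → ℝ) → (Fin n → ℝ)}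
    (hf_cd : ∀ y : Fin n → ℝ, ContDiff ℝ 1 fun x => f x y)
    {V : (Fin n → ℝ) → ℝ} (hV : ContDiff ℝ 2 V) {x : ℝ → Fin n → ℝ} {X : Fin n → ℝ} {u : ℝ}
    (hx : HasDerivAt x X u) (y : Fin n → ℝ) :
    HasDerivAt (fun s => fderiv ℝ V (x s) (f (x s) y))
      (∑ i, ((∑ j, X j * fderiv ℝ (fun z => fderiv ℝ V z (Pi.single i 1)) (x u) (Pi.single j 1))
            * f (x u) y i
          + fderiv ℝ V (x u) (Pi.single i 1) * ∑ j, X j * pd n f i j (x u) y)) u := by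
  have hsum : (fun s => fderiv ℝ V (x s) (f (x s) y))
      = fun s => ∑ i, fderiv ℝ V (x s) (Pi.single i 1) * f (x s) y i := by
    funext s
    rw [clm_apply_eq_sum_single]
    exact Finset.sum_congr rfl fun i _ => mul_comm _ _
  rw [hsum]
  refine HasDerivAt.fun_sum fun i _ => ?_
  have hgrad := (((contDiff_fderiv_single hV i).differentiable one_ne_zero)
    (x u)).hasFDerivAt.comp_hasDerivAt u hx
  rw [clm_apply_eq_sum_single] at hgrad
  have hd : DifferentiableAt ℝ (fun z => f z y i) (x u) :=
    (differentiable_pi.1 ((hf_cd y).differentiable one_ne_zero) i) (x u)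
  have hf := hd.hasFDerivAt.comp_hasDerivAt u hx
  rw [clm_apply_eq_sum_single] at hf
  simp only [fderiv_single_eq_pd hd] at hf
  exact hgrad.mul hf

theorem continuous_fderiv_apply {n : ℕ} {f : (Fin n → ℝ) → (Fin n → ℝ) → (Fin n → ℝ)}
    (hf : ∀ i, Continuous fun q : (Fin n → ℝ) × (Fin n → ℝ) => f q.1 q.2 i)
    {V : (Fin n → ℝ) → ℝ} (hV : ContDiff ℝ 2 V) {x : ℝ → Fin n → ℝ} (hx : Continuous x) :
    Continuous (Function.uncurry fun u s => fderiv ℝ V (x u) (f (x u) (x s))) := by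
  simp only [Function.uncurry_def]
  have h1 : Continuous fun z : ℝ × ℝ => fderiv ℝ V (x z.1) :=
    (hV.continuous_fderiv two_ne_zero).comp (hx.comp continuous_fst)
  refine h1.clm_apply (continuous_pi fun i => ?_)
  exact (hf i).comp ((hx.comp continuous_fst).prodMk (hx.comp continuous_snd))

theorem IsSol.exists_continuous_extension {n : ℕ} {h : ℝ}
    {f : (Fin n → ℝ) → (Fin n → ℝ) → (Fin n → ℝ)} {x : ℝ → Fin n → ℝ} (hh : 0 < h)
    (hx : IsSol n h f x) :
    ∃ y : ℝ → Fin n → ℝ, Continuous y ∧ (∀ s, -h ≤ s → y s = x s) ∧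
      ∀ t, 0 < t → HasDerivAt y (f (y t) (y (t - h))) t := by
  have heq (s : ℝ) (hs : -h ≤ s) : x (max s (-h)) = x s := by rw [max_eq_left hs]
  refine ⟨fun s => x (max s (-h)), hx.1.comp_continuous (by fun_prop) fun s => mem_Ici.2 (le_max_right _ _),
    heq, fun t ht => ?_⟩
  simp only [heq t (by linarith), heq (t - h) (by linarith)]
  refine ((hx.2 t ht.le).hasDerivAt (Ici_mem_nhds ht)).congr_of_eventuallyEq ?_
  filter_upwards [Ici_mem_nhds (by linarith : -h < t)] with s hs using heq s hs

theorem exists_first_hit {N : ℝ → ℝ} (hN : Continuous N) {δ t : ℝ} (ht : 0 ≤ t) (h0 : N 0 < δ)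
    (hδ : δ ≤ N t) : ∃ T, 0 < T ∧ N T = δ ∧ ∀ s ∈ Icc 0 T, N s ≤ δ := by
  set S := {s | 0 ≤ s ∧ δ ≤ N s} with hS
  have hSc : IsClosed S := isClosed_Ici.inter (isClosed_le continuous_const hN)
  have hSb : BddBelow S := ⟨0, fun s hs => hs.1⟩
  have hT : sInf S ∈ S := hSc.csInf_mem ⟨t, ht, hδ⟩ hSb
  have hlt (s : ℝ) (hs0 : 0 ≤ s) (hs : s < sInf S) : N s < δ := by
    by_contra! hle
    exact hs.not_ge (csInf_le hSb ⟨hs0, hle⟩)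
  have hTpos : 0 < sInf S := by
    refine hT.1.lt_of_ne fun h => ?_
    exact (h ▸ hT.2).not_gt h0
  have hle : N (sInf S) ≤ δ := by
    refine le_of_tendsto (hN.continuousWithinAt (s := Iio (sInf S)) (x := sInf S)) ?_
    filter_upwards [Ioo_mem_nhdsLT hTpos] with s hs using (hlt s hs.1.le hs.2).le
  refine ⟨sInf S, hTpos, hle.antisymm hT.2, fun s hs => ?_⟩
  rcases hs.2.eq_or_lt with rfl | h
  · exact hle
  · exact (hlt s hs.1 h).le

theorem hnorm_le_segNorm {n : ℕ} {r : Fin n → ℝ} {p h : ℝ} (hN : Continuous (hnorm n r p))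
    {x : ℝ → Fin n → ℝ} (hx : ContinuousOn x (Ici (-h))) {s : ℝ} (hs : s ∈ Icc (-h) 0) :
    hnorm n r p (x s) ≤ segNorm n r p h x 0 := by
  refine le_csSup ?_ ⟨s, hs, by simp only [zero_add]⟩
  refine isCompact_Icc.bddAbove_image ?_
  simp only [zero_add]
  exact hN.comp_continuousOn (hx.mono Icc_subset_Ici_self)

end

theorem stmt10
    (n : ℕ) (hn : 1 ≤ n) (r : Fin n → ℝ) (hr : ∀ i, 0 < r i) (p : ℝ) (hp : 1 ≤ p)
    (h μ : ℝ) (hh : 0 < h) (hμ : 0 < μ)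
    (f : (Fin n → ℝ) → (Fin n → ℝ) → (Fin n → ℝ))
    (hf_cd : ∀ y : Fin n → ℝ, ContDiff ℝ 1 fun x => f x y)
    (hf_lip : ∀ x : Fin n → ℝ, LocallyLipschitz fun y => f x y)
    (hf_hom : ∀ ε : ℝ, 0 < ε → ∀ x y : Fin n → ℝ, ∀ i,
      f (fun k => ε ^ r k * x k) (fun k => ε ^ r k * y k) i = ε ^ (μ + r i) * f x y i)
    (m : Fin n → ℝ) (hm : ∀ i, 0 < m i)
    (hfm : ∀ x y : Fin n → ℝ, ∀ i,
      |f x y i| ≤ m i * (hnorm n r p x ^ (μ + r i) + hnorm n r p y ^ (μ + r i)))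
    (η : Fin n → Fin n → ℝ) (hη : ∀ i j, 0 < η i j)
    (hfd1 : ∀ i j, 0 ≤ μ + r i - r j → ∀ x y : Fin n → ℝ,
      |pd n f i j x y| ≤ η i j * (hnorm n r p x ^ (μ + r i - r j) + hnorm n r p y ^ (μ + r i - r j)))
    (hfd2 : ∀ i j, μ + r i - r j < 0 → ∀ x y : Fin n → ℝ, |pd n f i j x y| ≤ η i j)
    (V : (Fin n → ℝ) → ℝ) (hV : ContDiff ℝ 2 V)
    (α0 α1 γ : ℝ) (hα0 : 0 < α0) (hα1 : 0 < α1) (hγ : ∀ i, 2 * r i ≤ γ)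
    (hVlb : ∀ x : Fin n → ℝ, α0 * hnorm n r p x ^ γ ≤ V x)
    (hVub : ∀ x : Fin n → ℝ, V x ≤ α1 * hnorm n r p x ^ γ)
    (β : Fin n → ℝ) (hβ : ∀ i, 0 < β i)
    (hVd : ∀ x : Fin n → ℝ, ∀ i,
      |fderiv ℝ V x (Pi.single i 1)| ≤ β i * hnorm n r p x ^ (γ - r i))
    (ψ : Fin n → Fin n → ℝ) (hψ : ∀ i j, 0 < ψ i j)
    (hVdd : ∀ x : Fin n → ℝ, ∀ i j,
      |fderiv ℝ (fun z => fderiv ℝ V z (Pi.single i 1)) x (Pi.single j 1)|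
        ≤ ψ i j * hnorm n r p x ^ (γ - r i - r j))
    (w : ℝ) (hw : 0 < w)
    (hVf : ∀ x : Fin n → ℝ, fderiv ℝ V x (f x x) ≤ -w * hnorm n r p x ^ (γ + μ))
    (w1 w2 : ℝ) (hw1 : 0 < w1) (hw2 : 0 < w2) (hw0 : 0 < w - w1 - h * w2)
    (χ : ℝ) (hχ : 0 < χ)
    (a2 : ℝ) (ha2def : a2 = w1 - ∑ i, β i * m i * χ ^ (2 * (γ - r i))) (ha2 : 0 < a2)
    (H1 : ℝ) (hH1def : H1 = (α0 / (h * ∑ i, β i * m i * (1 + χ ^ (-2 * (μ + r i))))) ^ (1 / μ))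
    (δ : ℝ) (hδ0 : 0 < δ) (hδH1 : δ < H1)
    (L : ℝ) (hLdef : L = ∑ i, ∑ j, m j * (β i * η i j *
      (if 0 ≤ μ + r i - r j then 1 else δ ^ (r j - r i - μ)) + m i * ψ i j))
    (H2 : ℝ) (hH2def : H2 = (min ((w - w1 - h * w2) / (4 * h * L))
      (min (w1 / (2 * h * L)) (w2 / (2 * L)))) ^ (1 / μ))
    (hδH2 : δ < H2)
    (a1 : ℝ) (ha1def : a1 = α0 - h * (∑ i, β i * m i * (1 + χ ^ (-2 * (μ + r i)))) * δ ^ μ)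
    (b3 : ℝ) (hb3def : b3 = (w1 + h * w2 + 2 * h * ∑ i, β i * m i) * h)
    (Δ : ℝ) (hΔ : 0 < Δ) (hroot : α1 * Δ ^ γ + b3 * Δ ^ (γ + μ) = a1 * δ ^ γ) :
    ∀ x : ℝ → Fin n → ℝ, IsSol n h f x → segNorm n r p h x 0 < Δ →
      ∀ t : ℝ, 0 ≤ t → hnorm n r p (x t) < δ := by
  intro x hsol hseg t ht
  by_contra! hcon
  have hp0 : 0 < p := by linarith
  have hγ0 : 0 < γ := by linarith [hγ ⟨0, hn⟩, hr ⟨0, hn⟩]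
  have hP : 0 < γ + μ := by linarith
  have hN : Continuous (hnorm n r p) := continuous_hnorm hr hp0
  set Q := ∑ i, β i * m i * (1 + χ ^ (-2 * (μ + r i))) with hQdef
  set R := ∑ i, β i * m i * χ ^ (2 * (γ - r i)) with hRdef
  have hQ0 : 0 ≤ Q := Finset.sum_nonneg fun i _ => by
    have := hβ i; have := hm i; positivity
  have hS0 : 0 ≤ ∑ i, β i * m i := Finset.sum_nonneg fun i _ => by
    have := hβ i; have := hm i; positivity
  have hL0 : 0 < L := by
    have : Nonempty (Fin n) := ⟨⟨0, hn⟩⟩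
    rw [hLdef]
    refine Finset.sum_pos (fun i _ => Finset.sum_pos (fun j _ => ?_) Finset.univ_nonempty)
      Finset.univ_nonempty
    have := hm i; have := hm j; have := hβ i; have := hη i j; have := hψ i j
    split_ifs <;> positivity
  -- smallness of `δ`
  have hδμ : δ ^ μ < min ((w - w1 - h * w2) / (4 * h * L))
      (min (w1 / (2 * h * L)) (w2 / (2 * L))) := by
    have hmin : 0 < min ((w - w1 - h * w2) / (4 * h * L))
        (min (w1 / (2 * h * L)) (w2 / (2 * L))) := by
      refine lt_min ?_ (lt_min ?_ ?_) <;> positivity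
    rw [hH2def] at hδH2
    have := Real.rpow_lt_rpow hδ0.le hδH2 hμ
    rwa [← Real.rpow_mul hmin.le, one_div_mul_cancel hμ.ne', Real.rpow_one] at this
  obtain ⟨hδa, hδb, hδc⟩ : δ ^ μ < _ ∧ δ ^ μ < _ ∧ δ ^ μ < _ := by simpa only [lt_min_iff] using hδμ
  rw [lt_div_iff₀ (by positivity)] at hδa hδb hδc
  have hδμ0 : 0 < δ ^ μ := Real.rpow_pos_of_pos hδ0 _
  -- the initial radius is below `δ`
  have hαα : α0 ≤ α1 := by
    have h1 := (hVlb fun _ => 1).trans (hVub fun _ => 1)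
    exact le_of_mul_le_mul_right h1 (Real.rpow_pos_of_pos (hnorm_one_pos hn r p) _)
  have hδγ0 : 0 < δ ^ γ := Real.rpow_pos_of_pos hδ0 _
  have hb3 : 0 ≤ b3 := by rw [hb3def]; positivity
  have hb3' : (w1 + h * w2) * h ≤ b3 := by
    rw [hb3def]
    refine mul_le_mul_of_nonneg_right ?_ hh.le
    have : 0 ≤ 2 * h * ∑ i, β i * m i := by positivity
    linarith
  have hΔP : 0 < Δ ^ (γ + μ) := Real.rpow_pos_of_pos hΔ _
  have ha1 : a1 * δ ^ γ = α0 * δ ^ γ - Q * (h * δ ^ (γ + μ)) := by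
    rw [ha1def, Real.rpow_add hδ0]; ring
  have hΔδ : Δ ≤ δ := by
    by_contra! hlt
    have h1 := Real.rpow_lt_rpow hδ0.le hlt hγ0
    have h2 := mul_lt_mul_of_pos_left h1 hα1
    have h3 := mul_le_mul_of_nonneg_right hαα hδγ0.le
    have h4 : 0 ≤ Q * (h * δ ^ (γ + μ)) := by positivity
    have h5 := mul_nonneg hb3 hΔP.le
    linarith
  -- first exit time of the extended solution
  obtain ⟨y, hyc, hyx, hy'⟩ := hsol.exists_continuous_extension hh
  have hNy : Continuous fun s => hnorm n r p (y s) := hN.comp hyc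
  set M := segNorm n r p h x 0 with hMdef
  have hM (s : ℝ) (hs : s ∈ Set.Icc (-h) 0) : hnorm n r p (y s) ≤ M := by
    rw [hyx s hs.1]
    exact hnorm_le_segNorm hN hsol.1 hs
  have hM0 : 0 ≤ M := (hnorm_nonneg n r p _).trans (hM 0 ⟨by linarith, le_rfl⟩)
  obtain ⟨T, hT0, hT, hTle⟩ := exists_first_hit hNy ht
    ((hM 0 ⟨by linarith, le_rfl⟩).trans_lt (hseg.trans_le hΔδ)) (by rwa [hyx t (by linarith)])
  have hball (s : ℝ) (hs : s ∈ Set.Icc (-h) T) : hnorm n r p (y s) ≤ δ := by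
    rcases le_total s 0 with h0 | h0
    · exact (hM s ⟨hs.1, h0⟩).trans (hseg.le.trans hΔδ)
    · exact hTle s ⟨h0, hs.2⟩
  have hfc := continuous_uncurry_of_lipschitzOnWith hf_lip
    (exists_lipschitzOnWith_closedBall hN hf_cd hη hfd1 hfd2)
  have hG := continuous_fderiv_apply hfc hV hyc
  have hgrowth := sub_le_of_delayed_deriv (v := fun s => V (y s))
    (n := fun s => hnorm n r p (y s) ^ (γ + μ))
    (G := fun u s => fderiv ℝ V (y u) (f (y u) (y s))) (c := δ ^ μ * L) (w := w) (w1 := w1)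
    (w2 := w2) (Q := Q) (B := M ^ (γ + μ)) (C := δ ^ (γ + μ)) hh hT0.le (hV.continuous.comp hyc)
    (hNy.rpow_const fun _ => Or.inr hP.le) (fun s => Real.rpow_nonneg (hnorm_nonneg n r p _) _)
    hG hQ0 (by positivity) hw1.le hw2.le
    (fun u hu => ((hV.differentiable two_ne_zero) (y u)).hasFDerivAt.comp_hasDerivAt u (hy' u hu))
    (fun s _ => hVf (y s)) ?_ ?_
    (fun s hs => Real.rpow_le_rpow (hnorm_nonneg n r p _) (hTle s hs) hP.le)
    (fun s hs => Real.rpow_le_rpow (hnorm_nonneg n r p _) (hM s hs) hP.le)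
    (by linarith) (by linarith) (by linarith) ?_
  · have h1 := hVlb (y T)
    have h2 := hVub (y 0)
    rw [hT] at h1
    have h3 := mul_le_mul_of_nonneg_left (Real.rpow_le_rpow (hnorm_nonneg n r p _)
      (hM 0 ⟨by linarith, le_rfl⟩) hγ0.le) hα1.le
    have h4 := mul_lt_mul_of_pos_left (Real.rpow_lt_rpow hM0 hseg hγ0) hα1
    have h5 := mul_le_mul hb3' (Real.rpow_le_rpow hM0 hseg.le hP.le) (by positivity) hb3
    linarith
  · intro s hs hsT
    refine intervalIntegral.sub_le_integral_of_hasDeriv_right_of_le (by linarith)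
      (hG.comp (continuous_id.prodMk continuous_const)).continuousOn
      (fun u hu => (hasDerivAt_fderiv_apply hf_cd hV (hy' u (by linarith [hu.1]))
        (y s)).hasDerivWithinAt) ?_ fun u hu => ?_
    · have hpow : Continuous fun s => hnorm n r p (y s) ^ (γ + μ) :=
        hNy.rpow_const fun _ => Or.inr hP.le
      refine Continuous.integrableOn_Icc (continuous_const.mul ?_)
      exact ((hpow.const_mul 4).add continuous_const).add
        ((hpow.comp (continuous_id.sub continuous_const)).const_mul 2)
    · rw [hLdef]
      exact sum_second_variation_le hr hμ hm hfm hη hfd1 hfd2 hγ0.le hγ hβ hVd hψ hVdd hδ0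
        (hball u ⟨by linarith [hu.1], by linarith [hu.2]⟩) (hball s ⟨by linarith, by linarith⟩)
        (hball (u - h) ⟨by linarith [hu.1], by linarith [hu.2]⟩)
  · intro u hu
    refine (le_abs_self _).trans
      ((fderiv_apply_le hr hμ hm hfm hγ hβ hVd hχ (y u) (y (u - h))).trans ?_)
    refine add_le_add_right (mul_le_mul (by linarith) ?_
      (Real.rpow_nonneg (hnorm_nonneg n r p _) _) hw1.le) _
    exact Real.rpow_le_rpow (hnorm_nonneg n r p _)
      (hM _ ⟨by linarith [hu.1], by linarith [hu.2]⟩) hP.le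
  · have h1 := decay_rate_le hn hr hμ hm hfm hγ hβ hVd hVf hχ
    have h2 : 0 < h * w2 := by positivity
    linarith
end

section
/- Let α > 1, ρ > 0, h > 0, γ > 0, μ > 0, Δ_α > 0, α_1 > 0, b_3 > 0, and suppose 1 + ρ h (μ/γ)(α_1 + b_3 Δ_α^{μ})^{μ/γ} Δ_α^{μ} ≤ α^{μ}. Let 0 < ũ_0 < (α_1 + b_3 Δ_α^{μ}) Δ_α^{γ} and u(t) = ũ_0 [1 + ρ(μ/γ) ũ_0^{μ/γ} t]^{−γ/μ}. Then u(t+θ) < α^{γ} u(t) for all t ≥ 0 and θ ∈ [−h, 0] such that t + θ ≥ 0. -/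
set_option linter.unusedVariables false

theorem stmt16
    (α ρ h γ μ Δα α1 b3 : ℝ)
    (hα : 1 < α) (hρ : 0 < ρ) (hh : 0 < h) (hγ : 0 < γ) (hμ : 0 < μ)
    (hΔα : 0 < Δα) (hα1 : 0 < α1) (hb3 : 0 < b3)
    (hcond : 1 + ρ * h * (μ / γ) * (α1 + b3 * Δα ^ μ) ^ (μ / γ) * Δα ^ μ ≤ α ^ μ)
    (u0 : ℝ) (hu00 : 0 < u0) (hu0lt : u0 < (α1 + b3 * Δα ^ μ) * Δα ^ γ) :
    ∀ t : ℝ, 0 ≤ t → ∀ θ ∈ Set.Icc (-h) (0:ℝ), 0 ≤ t + θ →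
      u0 * (1 + ρ * (μ / γ) * u0 ^ (μ / γ) * (t + θ)) ^ (-(γ / μ))
        < α ^ γ * (u0 * (1 + ρ * (μ / γ) * u0 ^ (μ / γ) * t) ^ (-(γ / μ))) := by
  intro t ht θ hθ hs
  have hK : 0 < α1 + b3 * Δα ^ μ := by positivity
  have hα0 : 0 < α := by linarith
  have hpow : u0 ^ (μ / γ) < (α1 + b3 * Δα ^ μ) ^ (μ / γ) * Δα ^ μ := by
    have h1 := Real.rpow_lt_rpow hu00.le hu0lt (div_pos hμ hγ)
    rwa [Real.mul_rpow hK.le (by positivity), ← Real.rpow_mul hΔα.le,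
      mul_div_cancel₀ μ hγ.ne'] at h1
  have hc : 0 < ρ * (μ / γ) * u0 ^ (μ / γ) := by positivity
  have hch : 1 + ρ * (μ / γ) * u0 ^ (μ / γ) * h < α ^ μ := by
    have h1 := mul_lt_mul_of_pos_left hpow (show 0 < ρ * h * (μ / γ) by positivity)
    linarith
  set c := ρ * (μ / γ) * u0 ^ (μ / γ)
  have hA : 0 < 1 + c * (t + θ) := by positivity
  have hB : 0 < 1 + c * t := by positivity
  have hBA : 1 + c * t < α ^ μ * (1 + c * (t + θ)) := by
    have h1 := mul_lt_mul_of_pos_right hch hA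
    have h2 : c * t ≤ c * (t + θ + h) := mul_le_mul_of_nonneg_left (by linarith [hθ.1]) hc.le
    have h3 : 0 ≤ c * h * (c * (t + θ)) := by positivity
    linarith
  have hroot : (1 + c * t) ^ (γ / μ) < α ^ γ * (1 + c * (t + θ)) ^ (γ / μ) := by
    have h1 := Real.rpow_lt_rpow hB.le hBA (div_pos hγ hμ)
    rwa [Real.mul_rpow (by positivity) hA.le, ← Real.rpow_mul hα0.le,
      mul_div_cancel₀ γ hμ.ne'] at h1
  rw [Real.rpow_neg hA.le, Real.rpow_neg hB.le, mul_left_comm]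
  refine mul_lt_mul_of_pos_left ?_ hu00
  rw [← div_eq_mul_inv, lt_div_iff₀ (by positivity), inv_mul_lt_iff₀ (by positivity)]
  linarith
end
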